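/- arXiv:1801.06981 — 3 statements merged into one kernel-verified Lean document; each statement's English description precedes it below -/
import Mathlib

section
/- There is a constant A ≥ 1, depending only on n, J, S and on bounds for g, such that the following holds. For each ν and each i ∈ {1,…,2n}, let V_{ν,i} = e_i − ⟨JΓ(y̲^ν), e_i⟩ e_{2n+1} ∈ ℝ^{2n+1} (coordinates (x,u)). Then for all y̲ ∈ Q_ν, all y_{2n} with |y_{2n}| ≤ 1, all v ∈ ℝ, all (x,u) with |x| + |u − u°| ≤ 2^{−l}, all σ with 2^{−l−2} ≤ |σ| ≤ 2^{−l+2} and all τ with 1/4 ≤ |τ| ≤ 4: |⟨V_{ν,i}, ∇_{(x,u)}Φ(σ,τ,x,u,y,v)⟩| ≤ A · (δ₁ + |x_{2n} − y_{2n} − g(x̲ − y̲)|). -/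
open MeasureTheory

/-- First `2n−1` coordinates of a vector in `ℝ^{2n}`. -/
def und {n : ℕ} (x : Fin (2 * n) → ℝ) : Fin (2 * n - 1) → ℝ :=
  fun i => x (Fin.castLE (by omega) i)

/-- Last coordinate of a vector in `ℝ^{2n}`. -/
def lastC {n : ℕ} (x : Fin (2 * n) → ℝ) : ℝ :=
  if h : 2 * n - 1 < 2 * n then x ⟨2 * n - 1, h⟩ else 0

/-- Pad a vector in `ℝ^{2n-1}` by a last coordinate to obtain a vector in `ℝ^{2n}`. -/
def pad {n : ℕ} (w : Fin (2 * n - 1) → ℝ) (t : ℝ) : Fin (2 * n) → ℝ :=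
  fun j => if h : (j : ℕ) < 2 * n - 1 then w ⟨j, h⟩ else t

/-- The bilinear form `xᵀJy`. -/
def bilJ {d : ℕ} (J : Matrix (Fin d) (Fin d) ℝ) (x y : Fin d → ℝ) : ℝ :=
  ∑ i, ∑ j, x i * J i j * y j

/-- Euclidean norm of a vector in `Fin d → ℝ`. -/
noncomputable def eucNorm {d : ℕ} (x : Fin d → ℝ) : ℝ :=
  Real.sqrt (∑ i, (x i) ^ 2)

/-- Nondegeneracy of the Hessian of `g` at `w`: `det D²g(w) ≠ 0`. -/
def HessNondeg {m : ℕ} (g : (Fin m → ℝ) → ℝ) (w : Fin m → ℝ) : Prop :=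
  (Matrix.of fun i j : Fin m =>
    iteratedFDeriv ℝ 2 g w ![Pi.single i 1, Pi.single j 1]).det ≠ 0

/-- The axis-parallel cube with corner `c` and side length `δ`. -/
def cube {m : ℕ} (c : Fin m → ℝ) (δ : ℝ) : Set (Fin m → ℝ) :=
  {y | ∀ i, c i ≤ y i ∧ y i ≤ c i + δ}

/-- `Γ(y̲) = (y̲, −g(−y̲)) ∈ ℝ^{2n}`. -/
noncomputable def Gam {n : ℕ} (g : (Fin (2 * n - 1) → ℝ) → ℝ)
    (w : Fin (2 * n - 1) → ℝ) : Fin (2 * n) → ℝ :=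
  pad w (-(g (-w)))

/-- `N(y̲) = e_{2n} − Σ_{i<2n} ∂_i g(−y̲) e_i`. -/
noncomputable def Nvec {n : ℕ} (g : (Fin (2 * n - 1) → ℝ) → ℝ)
    (w : Fin (2 * n - 1) → ℝ) : Fin (2 * n) → ℝ :=
  fun j => if h : (j : ℕ) < 2 * n - 1 then
    -(fderiv ℝ g (-w) (Pi.single (⟨j, h⟩ : Fin (2 * n - 1)) 1)) else 1

/-- The phase `Φ(σ,τ,x,u,y,v) = σ(x_{2n}−y_{2n}−g(x̲−y̲)) + τ(u−v+xᵀJy) + (τ/2)⟨Sx,x⟩`,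
as a function of `(x,u)`. -/
noncomputable def PhiFun {n : ℕ} (g : (Fin (2 * n - 1) → ℝ) → ℝ)
    (J S : Matrix (Fin (2 * n)) (Fin (2 * n)) ℝ)
    (σ τ : ℝ) (y : Fin (2 * n) → ℝ) (v : ℝ) :
    ((Fin (2 * n) → ℝ) × ℝ) → ℝ :=
  fun p => σ * (lastC p.1 - lastC y - g (und p.1 - und y))
    + τ * (p.2 - v + bilJ J p.1 y) + τ / 2 * bilJ S p.1 p.1

/-- `Ψ(σ,τ,x,u,y,v,ξ) = Φ(σ,τ,x,u,y,v) − ⟨x,ξ̄⟩ − u ξ_{2n+1}`, as a function of `(x,u)`. -/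
noncomputable def PsiFun {n : ℕ} (g : (Fin (2 * n - 1) → ℝ) → ℝ)
    (J S : Matrix (Fin (2 * n)) (Fin (2 * n)) ℝ)
    (σ τ : ℝ) (y : Fin (2 * n) → ℝ) (v : ℝ)
    (ξ : (Fin (2 * n) → ℝ) × ℝ) :
    ((Fin (2 * n) → ℝ) × ℝ) → ℝ :=
  fun p => PhiFun g J S σ τ y v p - (∑ i, p.1 i * ξ.1 i) - p.2 * ξ.2

lemma bilJ_eq_dotProduct {d : ℕ} (J : Matrix (Fin d) (Fin d) ℝ) (x y : Fin d → ℝ) :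
    bilJ J x y = x ⬝ᵥ J.mulVec y := by
  simp [bilJ, dotProduct, Matrix.mulVec, Finset.mul_sum, mul_assoc]

lemma abs_le_eucNorm {d : ℕ} (x : Fin d → ℝ) (i : Fin d) : |x i| ≤ eucNorm x :=
  Real.abs_le_sqrt
    (Finset.single_le_sum (f := fun i => x i ^ 2) (fun _ _ => sq_nonneg _) (Finset.mem_univ i))

lemma norm_le_eucNorm {d : ℕ} (x : Fin d → ℝ) : ‖x‖ ≤ eucNorm x :=
  (pi_norm_le_iff_of_nonneg (Real.sqrt_nonneg _)).2 fun i => abs_le_eucNorm x i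

lemma norm_und_le {n : ℕ} (x : Fin (2 * n) → ℝ) : ‖und x‖ ≤ ‖x‖ :=
  (pi_norm_le_iff_of_nonneg (norm_nonneg _)).2 fun _ => norm_le_pi_norm x _

lemma abs_lastC_le {n : ℕ} (x : Fin (2 * n) → ℝ) : |lastC x| ≤ ‖x‖ := by
  unfold lastC
  split_ifs
  · exact norm_le_pi_norm x _
  · simp

lemma norm_pad_sub_pad_le {n : ℕ} (w w' : Fin (2 * n - 1) → ℝ) (t t' : ℝ) {r : ℝ}
    (hr : 0 ≤ r) (hw : ‖w - w'‖ ≤ r) (ht : |t - t'| ≤ r) :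
    ‖(pad w t : Fin (2 * n) → ℝ) - pad w' t'‖ ≤ r := by
  refine (pi_norm_le_iff_of_nonneg hr).2 fun j => ?_
  simp only [Pi.sub_apply, pad]
  split_ifs with h
  · exact (norm_le_pi_norm (w - w') _).trans hw
  · exact ht

lemma und_pad {n : ℕ} (w : Fin (2 * n - 1) → ℝ) (t : ℝ) :
    und (pad w t : Fin (2 * n) → ℝ) = w := by
  ext i
  simp [und, pad]

lemma exists_abs_mulVec_le {d : ℕ} (M : Matrix (Fin d) (Fin d) ℝ) :
    ∃ K : ℝ, 0 ≤ K ∧ ∀ (w : Fin d → ℝ) (i : Fin d), |M.mulVec w i| ≤ K * ‖w‖ :=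
  ⟨‖LinearMap.toContinuousLinearMap M.mulVecLin‖, norm_nonneg _, fun w i =>
    (norm_le_pi_norm (M.mulVec w) i).trans
      ((LinearMap.toContinuousLinearMap M.mulVecLin).le_opNorm w)⟩

lemma norm_sub_le_of_mem_cube {m : ℕ} {c y z : Fin m → ℝ} {δ : ℝ} (hδ : 0 ≤ δ)
    (hy : y ∈ cube c δ) (hz : z ∈ cube c δ) : ‖y - z‖ ≤ δ :=
  (pi_norm_le_iff_of_nonneg hδ).2 fun i => by
    have h1 := hy i
    have h2 := hz i
    rw [Pi.sub_apply, Real.norm_eq_abs, abs_le]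
    constructor <;> linarith

lemma fderiv_PhiFun_apply {n : ℕ} {g : (Fin (2 * n - 1) → ℝ) → ℝ} (hg : Differentiable ℝ g)
    (J : Matrix (Fin (2 * n)) (Fin (2 * n)) ℝ) {S : Matrix (Fin (2 * n)) (Fin (2 * n)) ℝ}
    (hS : S.transpose = S) (σ τ : ℝ) (y : Fin (2 * n) → ℝ) (v : ℝ)
    (x e : Fin (2 * n) → ℝ) (u s : ℝ) :
    fderiv ℝ (PhiFun g J S σ τ y v) (x, u) (e, s)
      = σ * (lastC e - fderiv ℝ g (und x - und y) (und e))
        + τ * (s + e ⬝ᵥ J.mulVec y) + τ * (e ⬝ᵥ S.mulVec x) := by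
  have hund : Differentiable ℝ (und : (Fin (2 * n) → ℝ) → _) := by
    unfold und; fun_prop
  have hlast : Differentiable ℝ (lastC : (Fin (2 * n) → ℝ) → ℝ) := by
    unfold lastC; split_ifs <;> fun_prop
  have hd : DifferentiableAt ℝ (PhiFun g J S σ τ y v) (x, u) := by
    unfold PhiFun bilJ
    fun_prop
  have hsymm : x ⬝ᵥ S.mulVec e = e ⬝ᵥ S.mulVec x := by
    rw [Matrix.dotProduct_mulVec, ← Matrix.mulVec_transpose, hS, dotProduct_comm]
  have hline : (fun t : ℝ => PhiFun g J S σ τ y v ((x, u) + t • (e, s)))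
      = fun t : ℝ => σ * (lastC x + t * lastC e - lastC y - g (und x - und y + t • und e))
        + τ * (u + t * s - v + (x ⬝ᵥ J.mulVec y + t * (e ⬝ᵥ J.mulVec y)))
        + τ / 2 * (x ⬝ᵥ S.mulVec x + 2 * t * (e ⬝ᵥ S.mulVec x)
          + t ^ 2 * (e ⬝ᵥ S.mulVec e)) := by
    funext t
    have h1 : lastC (x + t • e) = lastC x + t * lastC e := by
      unfold lastC; split_ifs <;> simp
    have h2 : und (x + t • e) - und y = und x - und y + t • und e := by
      ext j; simp [und]; ring
    simp only [PhiFun, Prod.mk_add_mk, Prod.smul_mk, smul_eq_mul, bilJ_eq_dotProduct, h1, h2,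
      Matrix.mulVec_add, Matrix.mulVec_smul, dotProduct_add, add_dotProduct, smul_dotProduct,
      dotProduct_smul, hsymm]
    ring
  have hgl : HasDerivAt (fun t : ℝ => g (und x - und y + t • und e))
      (fderiv ℝ g (und x - und y) (und e)) 0 :=
    (hg _).hasFDerivAt.hasLineDerivAt _
  have hderiv := (((((hasDerivAt_id (0 : ℝ)).mul_const (lastC e)).const_add (lastC x)).sub_const
      (lastC y)).sub hgl).const_mul σ
    |>.add (((((hasDerivAt_id (0 : ℝ)).mul_const s).const_add u).sub_const v).add
      (((hasDerivAt_id (0 : ℝ)).mul_const (e ⬝ᵥ J.mulVec y)).const_add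
        (x ⬝ᵥ J.mulVec y)) |>.const_mul τ)
    |>.add (((((hasDerivAt_id (0 : ℝ)).const_mul 2).mul_const
      (e ⬝ᵥ S.mulVec x)).const_add (x ⬝ᵥ S.mulVec x)).add
      (((hasDerivAt_id (0 : ℝ)).pow 2).mul_const (e ⬝ᵥ S.mulVec e)) |>.const_mul (τ / 2))
  have hPhi := hd.hasFDerivAt.hasLineDerivAt (e, s)
  unfold HasLineDerivAt at hPhi
  rw [hline] at hPhi
  rw [hPhi.unique hderiv]
  simp
  ring

/-- the tangential directional derivatives of the modified phase `Φ`
satisfy `|⟨V_{ν,i}, ∇_{(x,u)}Φ⟩| ≤ A(δ₁ + |x_{2n}−y_{2n}−g(x̲−y̲)|)` on the admissible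
ranges of parameters, with `A` depending only on `n`, `J`, `S` and bounds for `g`. -/
theorem stmt10 (n : ℕ) (hn : 2 ≤ n)
    (J : Matrix (Fin (2 * n)) (Fin (2 * n)) ℝ)
    (hJskew : J.transpose = -J) (hJinv : IsUnit J.det)
    (g : (Fin (2 * n - 1) → ℝ) → ℝ) (hg : ContDiff ℝ (⊤ : ℕ∞) g)
    (hgrad0 : fderiv ℝ g 0 = 0)
    (hHess : ∀ w, eucNorm w ≤ 1 → HessNondeg g w)
    (S : Matrix (Fin (2 * n)) (Fin (2 * n)) ℝ)
    (hSsym : S.transpose = S) (hSinv : IsUnit S.det)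
    (hSe : S.mulVec ((J⁻¹).transpose.mulVec
        (Pi.single (⟨2 * n - 1, by omega⟩ : Fin (2 * n)) 1))
      = -(Pi.single (⟨2 * n - 1, by omega⟩ : Fin (2 * n)) 1)) :
    ∃ A : ℝ, 1 ≤ A ∧
      ∀ (k l : ℕ), 1 ≤ l → 3 * l ≤ k →
      ∀ δ₀ δ₁ : ℝ, (2 : ℝ) ^ (-(l : ℤ)) < δ₀ → δ₀ ≤ 1 → δ₁ < δ₀ →
        Real.sqrt ((2 : ℝ) ^ (-(l : ℤ)) * δ₀) ≤ δ₁ →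
      ∀ c : Fin (2 * n - 1) → ℝ,
        cube c δ₁ ⊆ {y | ∀ i, |y i| ≤ δ₀} →
      ∀ yν ∈ cube c δ₁,
      ∀ u₀ : ℝ, |u₀| ≤ 1 →
      ∀ i : Fin (2 * n),
      ∀ yb ∈ cube c δ₁, ∀ y2n : ℝ, |y2n| ≤ 1 → ∀ v : ℝ,
      ∀ (x : Fin (2 * n) → ℝ) (u : ℝ),
        eucNorm x + |u - u₀| ≤ (2 : ℝ) ^ (-(l : ℤ)) →
      ∀ σ : ℝ, (2 : ℝ) ^ (-(l : ℤ) - 2) ≤ |σ| → |σ| ≤ (2 : ℝ) ^ (-(l : ℤ) + 2) →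
      ∀ τ : ℝ, 1 / 4 ≤ |τ| → |τ| ≤ 4 →
        |fderiv ℝ (PhiFun g J S σ τ (pad yb y2n) v) (x, u)
            (Pi.single i 1, -((J.mulVec (Gam g yν)) i))|
          ≤ A * (δ₁ + |lastC x - y2n - g (und x - yb)|) := by
  obtain ⟨M, hM⟩ := (isCompact_closedBall (0 : Fin (2 * n - 1) → ℝ) 2).exists_bound_of_continuousOn
    (hg.continuous_fderiv (by simp)).continuousOn
  have hdiff : Differentiable ℝ g := hg.differentiable (by simp)
  have hM0 : 0 ≤ M := (norm_nonneg _).trans (hM 0 (by simp))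
  obtain ⟨KJ, hKJ0, hKJ⟩ := exists_abs_mulVec_le J
  obtain ⟨KS, hKS0, hKS⟩ := exists_abs_mulVec_le S
  refine ⟨4 * (1 + M) + 4 * (KJ * (2 + 2 * M)) + 4 * KS, by nlinarith [mul_nonneg hKJ0 hM0], ?_⟩
  intro k l hl _ δ₀ δ₁ hδ₀ hδ₀1 hδ₁ hsqrt c hc yν hyν u₀ _ i yb hyb y2n _ v x u hxu σ _ hσ τ _ hτ
  set ε : ℝ := (2 : ℝ) ^ (-(l : ℤ)) with hε
  set E : ℝ := lastC x - y2n - g (und x - yb) with hE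
  have hε0 : 0 < ε := by positivity
  have hεδ : ε ≤ δ₁ := (Real.le_sqrt_of_sq_le (by nlinarith)).trans hsqrt
  have hδ₁0 : 0 ≤ δ₁ := hε0.le.trans hεδ
  have hσ' : |σ| ≤ 4 * δ₁ := by
    rw [zpow_add₀ two_ne_zero] at hσ
    norm_num at hσ
    rw [zpow_neg, zpow_natCast] at hε
    linarith
  have hx : ‖x‖ ≤ δ₁ := by
    linarith [norm_le_eucNorm x, abs_nonneg (u - u₀)]
  have hux : ‖und x‖ ≤ δ₁ := (norm_und_le x).trans hx
  have hball : ∀ w ∈ cube c δ₁, ‖w‖ ≤ 1 := fun w hw =>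
    (pi_norm_le_iff_of_nonneg zero_le_one).2 fun j => (hc hw j).trans hδ₀1
  have hmem : und x - yb ∈ Metric.closedBall (0 : Fin (2 * n - 1) → ℝ) 2 := by
    rw [mem_closedBall_zero_iff]
    linarith [norm_sub_le (und x) yb, hball yb hyb]
  have hmem' : -yν ∈ Metric.closedBall (0 : Fin (2 * n - 1) → ℝ) 2 := by
    rw [mem_closedBall_zero_iff, norm_neg]
    linarith [hball yν hyν]
  have hyy : ‖yb - yν‖ ≤ δ₁ := norm_sub_le_of_mem_cube hδ₁0 hyb hyν
  have hgdiff : |g (und x - yb) - g (-yν)| ≤ M * (2 * δ₁) := by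
    refine ((convex_closedBall (0 : Fin (2 * n - 1) → ℝ) 2).norm_image_sub_le_of_norm_fderiv_le
      (fun w _ => hdiff w) hM hmem' hmem).trans (mul_le_mul_of_nonneg_left ?_ hM0)
    have : und x - yb - -yν = und x - (yb - yν) := by abel
    rw [this]
    linarith [norm_sub_le (und x) (yb - yν)]
  have hlast : |y2n - -(g (-yν))| ≤ (2 + 2 * M) * (δ₁ + |E|) := by
    have h1 : y2n - -(g (-yν)) = lastC x - E - (g (und x - yb) - g (-yν)) := by
      rw [hE]; ring
    rw [h1]
    have h2 := abs_sub (lastC x - E) (g (und x - yb) - g (-yν))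
    have h3 := abs_sub (lastC x) E
    have h4 := abs_lastC_le x
    nlinarith [abs_nonneg E, mul_nonneg hM0 (abs_nonneg E)]
  have hyy' : ‖yb - yν‖ ≤ (2 + 2 * M) * (δ₁ + |E|) := by
    nlinarith [abs_nonneg E, mul_nonneg hM0 (abs_nonneg E), mul_nonneg hM0 hδ₁0]
  have hpad : ‖(pad yb y2n : Fin (2 * n) → ℝ) - Gam g yν‖ ≤ (2 + 2 * M) * (δ₁ + |E|) :=
    norm_pad_sub_pad_le _ _ _ _ (by positivity) hyy' hlast
  have he : ‖(Pi.single i 1 : Fin (2 * n) → ℝ)‖ = 1 := by rw [Pi.norm_single, norm_one]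
  have hJ : |-(J.mulVec (Gam g yν) i) + J.mulVec (pad yb y2n) i|
      ≤ KJ * ((2 + 2 * M) * (δ₁ + |E|)) := by
    have h1 := (hKJ (pad yb y2n - Gam g yν) i).trans (mul_le_mul_of_nonneg_left hpad hKJ0)
    rwa [Matrix.mulVec_sub, Pi.sub_apply, sub_eq_neg_add] at h1
  have hSx : |S.mulVec x i| ≤ KS * δ₁ := (hKS x i).trans (mul_le_mul_of_nonneg_left hx hKS0)
  have hgrad : |lastC (Pi.single i 1 : Fin (2 * n) → ℝ)
      - fderiv ℝ g (und x - yb) (und (Pi.single i 1 : Fin (2 * n) → ℝ))| ≤ 1 + M := by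
    refine (abs_sub _ _).trans (add_le_add ((abs_lastC_le _).trans_eq he) ?_)
    refine (ContinuousLinearMap.le_of_opNorm_le_of_le _ (hM _ hmem)
      ((norm_und_le _).trans_eq he)).trans_eq (mul_one M)
  rw [fderiv_PhiFun_apply hdiff J hSsym, und_pad, single_one_dotProduct, single_one_dotProduct]
  refine (abs_add_three _ _ _).trans ?_
  rw [abs_mul, abs_mul, abs_mul]
  have h1 := mul_le_mul hσ' hgrad (abs_nonneg _) (by positivity)
  have h2 := mul_le_mul hτ hJ (abs_nonneg _) (by positivity)
  have h3 := mul_le_mul hτ hSx (abs_nonneg _) (by positivity)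
  have h4 : 0 ≤ (4 * (1 + M) + 4 * KS) * |E| := by positivity
  nlinarith [h1, h2, h3, h4]
end

section
/- Let J be an invertible skew-symmetric real 2n×2n matrix and J^# = (J^{−1})ᵀ = −J^{−1}. Then there exists a symmetric invertible real 2n×2n matrix S such that S J^# e_{2n} = −e_{2n} and min{1, |J^# e_{2n}|^{−1}} ≤ ‖S‖ ≤ max{1, |J^# e_{2n}|^{−1}}, where ‖S‖ denotes the ℓ²→ℓ² operator norm and e_{2n} is the last standard basis vector of ℝ^{2n}. -/
open Matrix in
/-- If `‖y‖ = c * ‖x‖` with `c > 0` and `x ≠ 0`, then `c` times a reflection sends `x` to `y`; it is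
given by a symmetric invertible matrix of operator norm `c`. -/
theorem exists_symm_isUnit_toEuclideanCLM_apply_eq {ι : Type*} [Fintype ι] [DecidableEq ι]
    {c : ℝ} (hc : 0 < c) {x y : EuclideanSpace ℝ ι} (hx : x ≠ 0) (hxy : ‖y‖ = c * ‖x‖) :
    ∃ S : Matrix ι ι ℝ, S.transpose = S ∧ IsUnit S.det ∧
      toEuclideanCLM (𝕜 := ℝ) S x = y ∧ ‖toEuclideanCLM (𝕜 := ℝ) S‖ = c := by
  have : Nontrivial (EuclideanSpace ℝ ι) := ⟨x, 0, hx⟩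
  set R := (ℝ ∙ (x - c⁻¹ • y))ᗮ.reflection with hR
  set T : EuclideanSpace ℝ ι →L[ℝ] EuclideanSpace ℝ ι :=
    c • (R : EuclideanSpace ℝ ι →L[ℝ] EuclideanSpace ℝ ι) with hT
  have hTapp (z) : T z = c • R z := rfl
  have hTT : T * T = (c * c) • 1 := by
    ext1 z
    simp [hTapp, hR, smul_smul]
  have hTx : T x = y := by
    rw [hTapp, hR, Submodule.reflection_sub, smul_inv_smul₀ hc.ne']
    rw [norm_smul, hxy, norm_inv, Real.norm_of_nonneg hc.le, inv_mul_cancel_left₀ hc.ne']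
  have hTnorm : ‖T‖ = c := by
    rw [hT, norm_smul, Real.norm_of_nonneg hc.le]
    have : ‖(R : EuclideanSpace ℝ ι →L[ℝ] EuclideanSpace ℝ ι)‖ = 1 :=
      R.toLinearIsometry.norm_toContinuousLinearMap
    rw [this, mul_one]
  have hTstar : star T = T := by
    refine ContinuousLinearMap.isSelfAdjoint_iff_isSymmetric.mpr fun a b => ?_
    change inner ℝ (c • R a) b = inner ℝ a (c • R b)
    rw [real_inner_smul_left, real_inner_smul_right, ← R.inner_map_map (R a) b, hR,
      Submodule.reflection_reflection]
  refine ⟨(toEuclideanCLM (n := ι) (𝕜 := ℝ)).symm T, ?_, ?_, ?_, ?_⟩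
  · rw [← conjTranspose_eq_transpose_of_trivial, ← star_eq_conjTranspose]
    exact (toEuclideanCLM (n := ι) (𝕜 := ℝ)).symm.map_star' T |>.symm.trans <| congrArg _ hTstar
  · rw [← isUnit_iff_isUnit_det]
    refine IsUnit.of_mul_eq_one ((c * c)⁻¹ • (toEuclideanCLM (n := ι) (𝕜 := ℝ)).symm T) ?_
    rw [mul_smul_comm, ← map_mul, hTT, map_smul, map_one, inv_smul_smul₀ (mul_pos hc hc).ne']
  · rwa [StarAlgEquiv.apply_symm_apply]
  · rwa [StarAlgEquiv.apply_symm_apply]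

theorem eucNorm_eq_norm_toLp {d : ℕ} (x : Fin d → ℝ) : eucNorm x = ‖WithLp.toLp 2 x‖ := by
  simp [eucNorm, EuclideanSpace.norm_eq]

/-- For an invertible skew-symmetric real `2n×2n` matrix `J`, with
`J^# = (J⁻¹)ᵀ = −J⁻¹`, there is a symmetric invertible matrix `S` with
`S J^# e_{2n} = −e_{2n}` and `min {1, |J^# e_{2n}|⁻¹} ≤ ‖S‖ ≤ max {1, |J^# e_{2n}|⁻¹}`,
where `‖S‖` is the `ℓ²→ℓ²` operator norm. -/
theorem stmt14 (n : ℕ) (hn : 1 ≤ n)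
    (J : Matrix (Fin (2 * n)) (Fin (2 * n)) ℝ)
    (hJskew : J.transpose = -J) (hJinv : IsUnit J.det)
    (e : Fin (2 * n) → ℝ) (he : e = Pi.single (⟨2 * n - 1, by omega⟩ : Fin (2 * n)) 1) :
    ∃ S : Matrix (Fin (2 * n)) (Fin (2 * n)) ℝ,
      S.transpose = S ∧ IsUnit S.det ∧
      S.mulVec ((J⁻¹).transpose.mulVec e) = -e ∧
      min 1 (eucNorm ((J⁻¹).transpose.mulVec e))⁻¹
        ≤ ‖Matrix.toEuclideanCLM (𝕜 := ℝ) S‖ ∧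
      ‖Matrix.toEuclideanCLM (𝕜 := ℝ) S‖
        ≤ max 1 (eucNorm ((J⁻¹).transpose.mulVec e))⁻¹ := by
  set v := (J⁻¹).transpose.mulVec e with hv
  have he0 : e ≠ 0 := by simp [he]
  have he1 : ‖WithLp.toLp 2 e‖ = 1 := by
    rw [he]
    exact (PiLp.norm_single 2 _ _ _).trans norm_one
  have hv0 : v ≠ 0 := by
    have hu : IsUnit (J⁻¹).transpose := by
      rw [Matrix.isUnit_transpose, Matrix.isUnit_nonsing_inv_iff, Matrix.isUnit_iff_isUnit_det]
      exact hJinv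
    intro h
    exact he0 (Matrix.mulVec_injective_of_isUnit hu (by rw [← hv, h, Matrix.mulVec_zero]))
  have hx0 : WithLp.toLp 2 v ≠ 0 := by simpa using hv0
  have hpos : 0 < ‖WithLp.toLp 2 v‖ := norm_pos_iff.mpr hx0
  obtain ⟨S, hS, hSdet, hSv, hSnorm⟩ :=
    exists_symm_isUnit_toEuclideanCLM_apply_eq (inv_pos.mpr hpos) hx0
      (y := -WithLp.toLp 2 e) (by rw [norm_neg, he1, inv_mul_cancel₀ hpos.ne'])
  refine ⟨S, hS, hSdet, ?_, ?_, ?_⟩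
  · exact congrArg WithLp.ofLp hSv
  · rw [hSnorm, eucNorm_eq_norm_toLp]
    exact min_le_right _ _
  · rw [hSnorm, eucNorm_eq_norm_toLp]
    exact le_max_right _ _
end

section
/- Let ψ: ℝ^d → ℝ be smooth and h ∈ C_c^∞(ℝ^d) with ∇ψ(w) ≠ 0 for all w ∈ supp h; define L a = div(a ∇ψ/|∇ψ|²) and iterates L^0 h = h, L^N h = L(L^{N−1}h). Then for every N ≥ 0 there exist finitely many constants c_{N,ν} (the number of terms K(N,d) depending only on N and d) such that L^N h = Σ_{ν=1}^{K(N,d)} c_{N,ν} h_{N,ν}, where each h_{N,ν} has, on a neighborhood of supp h, the form P(∇ψ/|∇ψ|) · β_A · Π_{l=1}^{M} γ_l, in which: P is a polynomial in d variables not depending on h or ψ; β_A is of type (A, j_A) for some 0 ≤ j_A ≤ N; each γ_l is of type (B, κ_l) with κ_l ≥ 1; and j_A + Σ_{l=1}^{M} κ_l = N. -/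
open MeasureTheory

/-- The operator `L a = div (a ∇ψ / |∇ψ|²)`. -/
noncomputable def Lop {d : ℕ} (ψ : EuclideanSpace ℝ (Fin d) → ℝ)
    (a : EuclideanSpace ℝ (Fin d) → ℝ) : EuclideanSpace ℝ (Fin d) → ℝ :=
  fun w => ∑ i, fderiv ℝ
    (fun w' => a w' * (gradient ψ w') i / ‖gradient ψ w'‖ ^ 2) w
    (EuclideanSpace.single i 1)

namespace IteratedLop

/-- Functionals of the phase `ψ`, the amplitude `h` and the point `w`. -/
abbrev Functional (d : ℕ) : Type :=
  (EuclideanSpace ℝ (Fin d) → ℝ) → (EuclideanSpace ℝ (Fin d) → ℝ) →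
    EuclideanSpace ℝ (Fin d) → ℝ

variable {d : ℕ}

/-- `f` is differentiable at `w` and its `i`-th partial derivative there is `a`. -/
def HasPartial (i : Fin d) (f : EuclideanSpace ℝ (Fin d) → ℝ) (a : ℝ)
    (w : EuclideanSpace ℝ (Fin d)) : Prop :=
  ∃ L : EuclideanSpace ℝ (Fin d) →L[ℝ] ℝ,
    HasFDerivAt f L w ∧ L (EuclideanSpace.single i 1) = a

namespace HasPartial

variable {i : Fin d} {f g : EuclideanSpace ℝ (Fin d) → ℝ} {a b : ℝ}
  {w : EuclideanSpace ℝ (Fin d)}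

theorem fderiv_apply (hf : HasPartial i f a w) :
    fderiv ℝ f w (EuclideanSpace.single i 1) = a := by
  obtain ⟨L, hL, rfl⟩ := hf
  rw [hL.fderiv]

theorem of_eq (hf : HasPartial i f a w) (hfg : f = g) (hab : a = b) :
    HasPartial i g b w :=
  hfg ▸ hab ▸ hf

theorem const (c : ℝ) : HasPartial i (fun _ => c) 0 w :=
  ⟨0, hasFDerivAt_const c w, by simp⟩

theorem add (hf : HasPartial i f a w) (hg : HasPartial i g b w) :
    HasPartial i (fun x => f x + g x) (a + b) w := by
  obtain ⟨L, hL, rfl⟩ := hf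
  obtain ⟨L', hL', rfl⟩ := hg
  exact ⟨L + L', hL.add hL', by simp⟩

theorem mul (hf : HasPartial i f a w) (hg : HasPartial i g b w) :
    HasPartial i (fun x => f x * g x) (a * g w + f w * b) w := by
  obtain ⟨L, hL, rfl⟩ := hf
  obtain ⟨L', hL', rfl⟩ := hg
  exact ⟨_, hL.mul hL', by simp; ring⟩

theorem comp {φ : ℝ → ℝ} {φ' : ℝ} (hφ : HasDerivAt φ φ' (f w)) (hf : HasPartial i f a w) :
    HasPartial i (fun x => φ (f x)) (φ' * a) w := by
  obtain ⟨L, hL, rfl⟩ := hf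
  exact ⟨_, hφ.comp_hasFDerivAt w hL, by simp⟩

theorem sum {ι : Type*} (s : Finset ι) {F : ι → EuclideanSpace ℝ (Fin d) → ℝ} {A : ι → ℝ}
    (h : ∀ k ∈ s, HasPartial i (F k) (A k) w) :
    HasPartial i (fun x => ∑ k ∈ s, F k x) (∑ k ∈ s, A k) w := by
  classical
  induction s using Finset.induction_on with
  | empty => simpa using const (i := i) (w := w) 0
  | insert k s hk ih =>
    simp only [Finset.sum_insert hk]
    exact (h k (Finset.mem_insert_self k s)).add
      (ih fun m hm => h m (Finset.mem_insert_of_mem hm))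

end HasPartial

theorem hasPartial_iteratedFDeriv {f : EuclideanSpace ℝ (Fin d) → ℝ}
    (hf : ContDiff ℝ (⊤ : ℕ∞) f) (n : ℕ) (m : Fin n → Fin d) (i : Fin d)
    (w : EuclideanSpace ℝ (Fin d)) :
    HasPartial i
      (fun x => iteratedFDeriv ℝ n f x (fun s => EuclideanSpace.single (m s) 1))
      (iteratedFDeriv ℝ (n + 1) f w
        (fun s => EuclideanSpace.single ((Fin.cons i m : Fin (n + 1) → Fin d) s) 1)) w := by
  have hd : DifferentiableAt ℝ (iteratedFDeriv ℝ n f) w :=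
    (hf.differentiable_iteratedFDeriv (by exact_mod_cast WithTop.coe_lt_top n)) w
  refine ⟨_, (ContinuousMultilinearMap.apply ℝ (fun _ : Fin n => EuclideanSpace ℝ (Fin d)) ℝ
    (fun s => EuclideanSpace.single (m s) 1)).hasFDerivAt.comp w hd.hasFDerivAt, ?_⟩
  rw [iteratedFDeriv_succ_apply_left]
  rfl

theorem gradient_apply {ψ : EuclideanSpace ℝ (Fin d) → ℝ} (w : EuclideanSpace ℝ (Fin d))
    (k : Fin d) :
    gradient ψ w k = iteratedFDeriv ℝ 1 ψ w
      (fun s => EuclideanSpace.single ((fun _ => k : Fin 1 → Fin d) s) 1) := by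
  rw [iteratedFDeriv_one_apply]
  have h := InnerProductSpace.toDual_symm_apply (𝕜 := ℝ)
    (x := EuclideanSpace.single k (1 : ℝ)) (y := fderiv ℝ ψ w)
  rw [← h, EuclideanSpace.inner_single_right]
  simp [gradient]

/-- The `k`-th component of `∇ψ / |∇ψ|`. -/
noncomputable def unitGrad (k : Fin d) : Functional d :=
  fun ψ _ w => gradient ψ w k / ‖gradient ψ w‖

/-- A polynomial in the components of `∇ψ / |∇ψ|`. -/
noncomputable def polyFactor (P : MvPolynomial (Fin d) ℝ) : Functional d :=
  fun ψ _ w => MvPolynomial.eval (fun i => gradient ψ w i / ‖gradient ψ w‖) P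

/-- A function of type `(A, j)`, given by `j` and the list of differentiation directions. -/
noncomputable def typeA (α : Σ j : ℕ, Fin j → Fin d) : Functional d :=
  fun ψ h w => iteratedFDeriv ℝ α.1 h w (fun s => EuclideanSpace.single (α.2 s) 1)
    / ‖gradient ψ w‖ ^ α.1

/-- A function of type `(B, k + 1)`, given by `k` and the list of differentiation directions. -/
noncomputable def typeB (β : Σ k : ℕ, Fin (k + 1 + 1) → Fin d) : Functional d :=
  fun ψ _ w => iteratedFDeriv ℝ (β.1 + 1 + 1) ψ w
    (fun s => EuclideanSpace.single (β.2 s) 1) / ‖gradient ψ w‖ ^ (β.1 + 1 + 1)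

/-- The total order of a list of functions of type `B`. -/
def weight (l : List (Σ k : ℕ, Fin (k + 1 + 1) → Fin d)) : ℕ :=
  (l.map fun β => β.1 + 1).sum

/-- Linear combinations of products of a polynomial in `∇ψ / |∇ψ|` and functions of type `B` of
total order `n`. -/
noncomputable def spanB (d n : ℕ) : Submodule ℝ (Functional d) :=
  Submodule.span ℝ {T | ∃ P l, weight l = n ∧ T = polyFactor P * (l.map typeB).prod}

/-- Linear combinations of products of a polynomial in `∇ψ / |∇ψ|`, a function of type `A` and
functions of type `B`, of total order `n`. -/
noncomputable def spanAB (d n : ℕ) : Submodule ℝ (Functional d) :=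
  Submodule.span ℝ {T | ∃ P α l, α.1 + weight l = n ∧
    T = polyFactor P * typeA α * (l.map typeB).prod}

theorem polyFactor_mul (P Q : MvPolynomial (Fin d) ℝ) :
    polyFactor (P * Q) = polyFactor P * polyFactor Q := by
  funext ψ h w
  simp [polyFactor]

theorem weight_append (l l' : List (Σ k : ℕ, Fin (k + 1 + 1) → Fin d)) :
    weight (l ++ l') = weight l + weight l' := by
  simp [weight]

theorem mul_mem_spanB {m n : ℕ} {S T : Functional d} (hS : S ∈ spanB d m)
    (hT : T ∈ spanB d n) : S * T ∈ spanB d (m + n) := by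
  have h : spanB d m * spanB d n ≤ spanB d (m + n) := by
    rw [spanB, spanB, Submodule.span_mul_span, Submodule.span_le]
    rintro _ ⟨_, ⟨P, l, rfl, rfl⟩, _, ⟨Q, l', rfl, rfl⟩, rfl⟩
    refine Submodule.subset_span ⟨P * Q, l ++ l', weight_append l l', ?_⟩
    simp only [polyFactor_mul, List.map_append, List.prod_append]
    ring
  exact h (Submodule.mul_mem_mul hS hT)

theorem mul_mem_spanAB {m n : ℕ} {S T : Functional d} (hS : S ∈ spanAB d m)
    (hT : T ∈ spanB d n) : S * T ∈ spanAB d (m + n) := by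
  have h : spanAB d m * spanB d n ≤ spanAB d (m + n) := by
    rw [spanAB, spanB, Submodule.span_mul_span, Submodule.span_le]
    rintro _ ⟨_, ⟨P, α, l, rfl, rfl⟩, _, ⟨Q, l', rfl, rfl⟩, rfl⟩
    refine Submodule.subset_span ⟨P * Q, α, l ++ l', by rw [weight_append, add_assoc], ?_⟩
    simp only [polyFactor_mul, List.map_append, List.prod_append]
    ring
  exact h (Submodule.mul_mem_mul hS hT)

theorem polyFactor_mem (P : MvPolynomial (Fin d) ℝ) : polyFactor P ∈ spanB d 0 :=
  Submodule.subset_span ⟨P, [], rfl, by simp⟩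

theorem polyFactor_one : polyFactor (1 : MvPolynomial (Fin d) ℝ) = 1 := by
  funext ψ h w
  simp [polyFactor]

theorem polyFactor_X (k : Fin d) : polyFactor (MvPolynomial.X k) = unitGrad k := by
  funext ψ h w
  simp [polyFactor, unitGrad]

theorem unitGrad_mem (k : Fin d) : unitGrad k ∈ spanB d 0 :=
  polyFactor_X k ▸ polyFactor_mem _

theorem typeB_mem (β : Σ k : ℕ, Fin (k + 1 + 1) → Fin d) : typeB β ∈ spanB d (β.1 + 1) :=
  Submodule.subset_span ⟨1, [β], by simp [weight], by simp [polyFactor_one]⟩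

theorem typeA_mem (α : Σ j : ℕ, Fin j → Fin d) : typeA α ∈ spanAB d α.1 :=
  Submodule.subset_span ⟨1, α, [], by simp [weight], by simp [polyFactor_one]⟩

/-- `|∇ψ|⁻²` times the `i`-th partial derivative of `|∇ψ|`. -/
noncomputable def normFactor (i : Fin d) : Functional d :=
  ∑ k, unitGrad k * typeB ⟨0, Fin.cons i fun _ => k⟩

theorem normFactor_mem (i : Fin d) : normFactor i ∈ spanB d 1 :=
  Submodule.sum_mem _ fun k _ => by
    simpa using mul_mem_spanB (unitGrad_mem k) (typeB_mem ⟨0, Fin.cons i fun _ => k⟩)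

theorem hasPartial_gradient {ψ : EuclideanSpace ℝ (Fin d) → ℝ} (hψ : ContDiff ℝ (⊤ : ℕ∞) ψ)
    (i k : Fin d) (w : EuclideanSpace ℝ (Fin d)) :
    HasPartial i (fun x => gradient ψ x k)
      (iteratedFDeriv ℝ 2 ψ w (fun s => EuclideanSpace.single
        ((Fin.cons i fun _ => k : Fin 2 → Fin d) s) 1)) w := by
  simp only [gradient_apply]
  exact hasPartial_iteratedFDeriv hψ 1 (fun _ => k) i w

theorem hasPartial_norm_gradient {ψ : EuclideanSpace ℝ (Fin d) → ℝ}
    (hψ : ContDiff ℝ (⊤ : ℕ∞) ψ) (h : EuclideanSpace ℝ (Fin d) → ℝ) (i : Fin d)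
    {w : EuclideanSpace ℝ (Fin d)} (hw : gradient ψ w ≠ 0) :
    HasPartial i (fun x => ‖gradient ψ x‖) (‖gradient ψ w‖ ^ 2 * normFactor i ψ h w) w := by
  have hn : ‖gradient ψ w‖ ≠ 0 := norm_ne_zero_iff.2 hw
  have hs : ∀ x, ‖gradient ψ x‖ = √(∑ k, gradient ψ x k * gradient ψ x k) := fun x => by
    simp [EuclideanSpace.norm_eq, sq]
  have hpos : ∑ k, gradient ψ w k * gradient ψ w k ≠ 0 := fun h0 => hn (by simp [hs, h0])
  have key := HasPartial.comp (Real.hasDerivAt_sqrt hpos)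
    (HasPartial.sum Finset.univ fun k _ =>
      (hasPartial_gradient hψ i k w).mul (hasPartial_gradient hψ i k w))
  simp only [← hs] at key
  convert key using 1
  simp only [normFactor, Finset.sum_apply, Pi.mul_apply, unitGrad, typeB, Finset.mul_sum]
  refine Finset.sum_congr rfl fun k _ => ?_
  field_simp
  ring

/-- For smooth `ψ`, `h` and nonvanishing `∇ψ`, the `i`-th partial derivative of `T` is
`|∇ψ| * T'`. -/
def ScaledPartial (i : Fin d) (T T' : Functional d) : Prop :=
  ∀ ψ h, ContDiff ℝ (⊤ : ℕ∞) ψ → ContDiff ℝ (⊤ : ℕ∞) h → ∀ w, gradient ψ w ≠ 0 →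
    HasPartial i (T ψ h) (‖gradient ψ w‖ * T' ψ h w) w

namespace ScaledPartial

variable {i : Fin d} {S S' T T' : Functional d}

theorem add (hS : ScaledPartial i S S') (hT : ScaledPartial i T T') :
    ScaledPartial i (S + T) (S' + T') := fun ψ h hψ hh w hw => by
  refine ((hS ψ h hψ hh w hw).add (hT ψ h hψ hh w hw)).of_eq rfl ?_
  simp only [Pi.add_apply]
  ring

theorem mul (hS : ScaledPartial i S S') (hT : ScaledPartial i T T') :
    ScaledPartial i (S * T) (S' * T + S * T') := fun ψ h hψ hh w hw => by
  refine ((hS ψ h hψ hh w hw).mul (hT ψ h hψ hh w hw)).of_eq rfl ?_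
  simp only [Pi.add_apply, Pi.mul_apply]
  ring

theorem const (c : ℝ) : ScaledPartial i (fun _ _ _ => c : Functional d) 0 :=
  fun ψ h _ _ w _ => by simpa using HasPartial.const (i := i) (w := w) c

theorem smul (c : ℝ) (hT : ScaledPartial i T T') : ScaledPartial i (c • T) (c • T') :=
  fun ψ h hψ hh w hw => by
    refine ((HasPartial.const c).mul (hT ψ h hψ hh w hw)).of_eq rfl ?_
    simp only [Pi.smul_apply, smul_eq_mul]
    ring

theorem div_norm_pow {Q Q' : Functional d} (j : ℕ)
    (hQ : ∀ ψ h, ContDiff ℝ (⊤ : ℕ∞) ψ → ContDiff ℝ (⊤ : ℕ∞) h → ∀ w,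
      HasPartial i (Q ψ h) (Q' ψ h w) w) :
    ScaledPartial i (fun ψ h w => Q ψ h w / ‖gradient ψ w‖ ^ j)
      ((fun ψ h w => Q' ψ h w / ‖gradient ψ w‖ ^ (j + 1)) +
        (-(j : ℝ)) • ((fun ψ h w => Q ψ h w / ‖gradient ψ w‖ ^ j) * normFactor i)) :=
  fun ψ h hψ hh w hw => by
    have hn : ‖gradient ψ w‖ ≠ 0 := norm_ne_zero_iff.2 hw
    have hd := ((hasDerivAt_pow j ‖gradient ψ w‖).inv (pow_ne_zero j hn))
    refine ((hQ ψ h hψ hh w).mul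
      (HasPartial.comp hd (hasPartial_norm_gradient hψ h i hw))).of_eq rfl ?_
    simp only [Pi.add_apply, Pi.mul_apply, Pi.smul_apply, smul_eq_mul, Pi.inv_apply]
    rcases j with _ | j
    · simp
      field_simp
    · simp only [Nat.add_sub_cancel]
      field_simp
      ring

end ScaledPartial

theorem exists_scaledPartial_unitGrad (i k : Fin d) :
    ∃ T' ∈ spanB d 1, ScaledPartial i (unitGrad k) T' := by
  refine ⟨typeB ⟨0, Fin.cons i fun _ => k⟩ + (-((1 : ℕ) : ℝ)) • (unitGrad k * normFactor i),
    add_mem (typeB_mem ⟨0, Fin.cons i fun _ => k⟩) (Submodule.smul_mem _ _ ?_), ?_⟩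
  · simpa using mul_mem_spanB (unitGrad_mem k) (normFactor_mem i)
  · have := ScaledPartial.div_norm_pow (i := i) (Q := fun ψ _ w => gradient ψ w k) 1
      fun ψ _ hψ _ w => hasPartial_gradient hψ i k w
    simp only [pow_one] at this
    exact this

theorem exists_scaledPartial_polyFactor (i : Fin d) (P : MvPolynomial (Fin d) ℝ) :
    ∃ T' ∈ spanB d 1, ScaledPartial i (polyFactor P) T' := by
  induction P using MvPolynomial.induction_on with
  | C c =>
    refine ⟨0, zero_mem _, ?_⟩
    convert ScaledPartial.const (i := i) c using 1
    funext ψ h w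
    simp [polyFactor]
  | add P Q hP hQ =>
    obtain ⟨S, hS, hPS⟩ := hP
    obtain ⟨T, hT, hQT⟩ := hQ
    refine ⟨S + T, add_mem hS hT, ?_⟩
    convert hPS.add hQT using 1
    funext ψ h w
    simp [polyFactor]
  | mul_X P k hP =>
    obtain ⟨S, hS, hPS⟩ := hP
    obtain ⟨T, hT, hkT⟩ := exists_scaledPartial_unitGrad i k
    rw [polyFactor_mul, polyFactor_X]
    refine ⟨_, add_mem ?_ ?_, hPS.mul hkT⟩
    · simpa using mul_mem_spanB hS (unitGrad_mem k)
    · simpa using mul_mem_spanB (polyFactor_mem P) hT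

theorem exists_scaledPartial_typeB (i : Fin d) (β : Σ k : ℕ, Fin (k + 1 + 1) → Fin d) :
    ∃ T' ∈ spanB d (β.1 + 1 + 1), ScaledPartial i (typeB β) T' :=
  ⟨typeB ⟨β.1 + 1, Fin.cons i β.2⟩ +
      (-((β.1 + 1 + 1 : ℕ) : ℝ)) • (typeB β * normFactor i),
    add_mem (typeB_mem ⟨β.1 + 1, Fin.cons i β.2⟩)
      (Submodule.smul_mem _ _ (mul_mem_spanB (typeB_mem β) (normFactor_mem i))),
    ScaledPartial.div_norm_pow _ fun _ _ hψ _ w =>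
      hasPartial_iteratedFDeriv hψ (β.1 + 1 + 1) β.2 i w⟩

theorem exists_scaledPartial_typeA (i : Fin d) (α : Σ j : ℕ, Fin j → Fin d) :
    ∃ T' ∈ spanAB d (α.1 + 1), ScaledPartial i (typeA α) T' :=
  ⟨typeA ⟨α.1 + 1, Fin.cons i α.2⟩ + (-(α.1 : ℝ)) • (typeA α * normFactor i),
    add_mem (typeA_mem ⟨α.1 + 1, Fin.cons i α.2⟩)
      (Submodule.smul_mem _ _ (mul_mem_spanAB (typeA_mem α) (normFactor_mem i))),
    ScaledPartial.div_norm_pow _ fun _ _ _ hh w => hasPartial_iteratedFDeriv hh α.1 α.2 i w⟩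

theorem prod_typeB_mem (l : List (Σ k : ℕ, Fin (k + 1 + 1) → Fin d)) :
    (l.map typeB).prod ∈ spanB d (weight l) :=
  Submodule.subset_span ⟨1, l, rfl, by rw [polyFactor_one, one_mul]⟩

theorem exists_scaledPartial_prod_typeB (i : Fin d)
    (l : List (Σ k : ℕ, Fin (k + 1 + 1) → Fin d)) :
    ∃ T' ∈ spanB d (weight l + 1), ScaledPartial i (l.map typeB).prod T' := by
  induction l with
  | nil => exact ⟨0, zero_mem _, ScaledPartial.const 1⟩
  | cons β l ih =>
    obtain ⟨S, hS, hβS⟩ := exists_scaledPartial_typeB i β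
    obtain ⟨T, hT, hlT⟩ := ih
    rw [List.map_cons, List.prod_cons]
    refine ⟨_, add_mem ?_ ?_, hβS.mul hlT⟩
    · convert mul_mem_spanB hS (prod_typeB_mem l) using 2
      simp only [weight, List.map_cons, List.sum_cons]
      ring
    · convert mul_mem_spanB (typeB_mem β) hT using 2
      simp only [weight, List.map_cons, List.sum_cons]
      ring

theorem exists_scaledPartial {n : ℕ} (i : Fin d) {T : Functional d} (hT : T ∈ spanAB d n) :
    ∃ T' ∈ spanAB d (n + 1), ScaledPartial i T T' := by
  induction hT using Submodule.span_induction with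
  | mem T hT =>
    obtain ⟨P, α, l, rfl, rfl⟩ := hT
    obtain ⟨R, hR, hPR⟩ := exists_scaledPartial_polyFactor i P
    obtain ⟨S, hS, hαS⟩ := exists_scaledPartial_typeA i α
    obtain ⟨T, hT, hlT⟩ := exists_scaledPartial_prod_typeB i l
    have hSR : S * polyFactor P + typeA α * R ∈ spanAB d (α.1 + 1) :=
      add_mem (mul_mem_spanAB (n := 0) hS (polyFactor_mem P)) (mul_mem_spanAB (typeA_mem α) hR)
    have hαP : typeA α * polyFactor P ∈ spanAB d α.1 :=
      mul_mem_spanAB (n := 0) (typeA_mem α) (polyFactor_mem P)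
    rw [mul_comm (polyFactor P)]
    refine ⟨_, add_mem ?_ ?_, (hαS.mul hPR).mul hlT⟩
    · rw [add_right_comm]
      exact mul_mem_spanAB hSR (prod_typeB_mem l)
    · rw [add_assoc]
      exact mul_mem_spanAB hαP hT
  | zero => exact ⟨0, zero_mem _, ScaledPartial.const 0⟩
  | add S T _ _ hS hT =>
    obtain ⟨S', hS', hSS'⟩ := hS
    obtain ⟨T', hT', hTT'⟩ := hT
    exact ⟨_, add_mem hS' hT', hSS'.add hTT'⟩
  | smul c T _ hT =>
    obtain ⟨T', hT', hTT'⟩ := hT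
    exact ⟨c • T', Submodule.smul_mem _ c hT', hTT'.smul c⟩

theorem exists_Lop_eq {n : ℕ} {T : Functional d} (hT : T ∈ spanAB d n) :
    ∃ T' ∈ spanAB d (n + 1), ∀ ψ h, ContDiff ℝ (⊤ : ℕ∞) ψ → ContDiff ℝ (⊤ : ℕ∞) h →
      ∀ w, gradient ψ w ≠ 0 → Lop ψ (T ψ h) w = T' ψ h w := by
  have hmul : ∀ i, T * unitGrad i ∈ spanAB d n := fun i =>
    mul_mem_spanAB (n := 0) hT (unitGrad_mem i)
  choose S hS hTS using fun i => exists_scaledPartial i (hmul i)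
  refine ⟨∑ i, (S i - T * unitGrad i * normFactor i), Submodule.sum_mem _ fun i _ =>
    sub_mem (hS i) (mul_mem_spanAB (hmul i) (normFactor_mem i)), fun ψ h hψ hh w hw => ?_⟩
  simp only [Lop, Finset.sum_apply]
  refine Finset.sum_congr rfl fun i _ => ?_
  have hn : ‖gradient ψ w‖ ≠ 0 := norm_ne_zero_iff.2 hw
  have key := (hTS i ψ h hψ hh w hw).mul
    (HasPartial.comp (hasDerivAt_inv hn) (hasPartial_norm_gradient hψ h i hw))
  have hfun : (fun x => T ψ h x * gradient ψ x i / ‖gradient ψ x‖ ^ 2) =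
      fun x => (T * unitGrad i) ψ h x * ‖gradient ψ x‖⁻¹ := by
    funext x
    simp only [Pi.mul_apply, unitGrad]
    ring
  rw [hfun, key.fderiv_apply]
  simp only [Pi.mul_apply, Pi.sub_apply]
  field_simp
  ring

theorem Lop_congr {ψ a b : EuclideanSpace ℝ (Fin d) → ℝ} {U : Set (EuclideanSpace ℝ (Fin d))}
    (hU : IsOpen U) (hab : Set.EqOn a b U) : Set.EqOn (Lop ψ a) (Lop ψ b) U := by
  intro w hw
  refine Finset.sum_congr rfl fun i _ => ?_
  congr 1
  apply Filter.EventuallyEq.fderiv_eq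
  filter_upwards [hU.mem_nhds hw] with x hx
  rw [hab hx]

theorem exists_iterate_Lop_eq (d N : ℕ) :
    ∃ T ∈ spanAB d N, ∀ ψ h, ContDiff ℝ (⊤ : ℕ∞) ψ → ContDiff ℝ (⊤ : ℕ∞) h →
      ∀ U : Set (EuclideanSpace ℝ (Fin d)), IsOpen U → (∀ w ∈ U, gradient ψ w ≠ 0) →
        Set.EqOn ((Lop ψ)^[N] h) (T ψ h) U := by
  induction N with
  | zero =>
    refine ⟨_, typeA_mem ⟨0, Fin.elim0⟩, fun ψ h _ _ U _ _ w _ => ?_⟩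
    simp [typeA]
  | succ N ih =>
    obtain ⟨T, hT, hL⟩ := ih
    obtain ⟨T', hT', hL'⟩ := exists_Lop_eq hT
    refine ⟨T', hT', fun ψ h hψ hh U hU hg w hw => ?_⟩
    rw [Function.iterate_succ_apply', Lop_congr hU (hL ψ h hψ hh U hU hg) hw,
      hL' ψ h hψ hh w (hg w hw)]

end IteratedLop

/-- structure of the iterates `L^N h`.  For every `N` there are finitely many
universal constants `c_{N,ν}` (their number depending only on `N` and `d`), universal
polynomials `P_ν`, and universal combinatorial data (orders `j_A`, `κ_l ≥ 1` with
`j_A + Σ κ_l = N`, together with the multi-indices giving the derivatives of `h` and `ψ`),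
such that for every smooth `ψ` with nonvanishing gradient on a neighborhood `U` of
`supp h` and every `h ∈ C_c^∞`, on `U` one has
`L^N h = Σ_ν c_ν · P_ν(∇ψ/|∇ψ|) · β_{A,ν} · Π_l γ_{ν,l}`, where `β_{A,ν}` is of type
`(A, j_A(ν))` and each `γ_{ν,l}` is of type `(B, κ(ν,l))`. -/
theorem stmt17 (d : ℕ) (N : ℕ) :
    ∃ (K : ℕ) (c : Fin K → ℝ) (P : Fin K → MvPolynomial (Fin d) ℝ)
      (jA : Fin K → ℕ) (M : Fin K → ℕ) (κ : (ν : Fin K) → Fin (M ν) → ℕ)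
      (mA : (ν : Fin K) → Fin (jA ν) → Fin d)
      (mB : (ν : Fin K) → (l : Fin (M ν)) → Fin (κ ν l + 1) → Fin d),
      (∀ ν, jA ν ≤ N) ∧
      (∀ ν l, 1 ≤ κ ν l) ∧
      (∀ ν, jA ν + ∑ l, κ ν l = N) ∧
      (∀ (ψ h : EuclideanSpace ℝ (Fin d) → ℝ),
        ContDiff ℝ (⊤ : ℕ∞) ψ → ContDiff ℝ (⊤ : ℕ∞) h → HasCompactSupport h →
        ∀ U : Set (EuclideanSpace ℝ (Fin d)), IsOpen U → tsupport h ⊆ U →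
        (∀ w ∈ U, gradient ψ w ≠ 0) →
        ∀ w ∈ U,
          (Lop ψ)^[N] h w =
            ∑ ν, c ν *
              MvPolynomial.eval (fun i => (gradient ψ w) i / ‖gradient ψ w‖) (P ν) *
              (iteratedFDeriv ℝ (jA ν) h w (fun s => EuclideanSpace.single (mA ν s) 1)
                / ‖gradient ψ w‖ ^ (jA ν)) *
              ∏ l, (iteratedFDeriv ℝ (κ ν l + 1) ψ w
                  (fun s => EuclideanSpace.single (mB ν l s) 1)
                / ‖gradient ψ w‖ ^ (κ ν l + 1))) := by
  obtain ⟨T, hT, hL⟩ := IteratedLop.exists_iterate_Lop_eq d N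
  obtain ⟨K, c, g, rfl⟩ := Submodule.mem_span_set'.1 hT
  choose P α l hwt hg using fun ν => (g ν).2
  refine ⟨K, c, P, fun ν => (α ν).1, fun ν => (l ν).length, fun ν s => ((l ν).get s).1 + 1,
    fun ν => (α ν).2, fun ν s => ((l ν).get s).2, fun ν => ?_, fun ν s => by simp, fun ν => ?_,
    fun ψ h hψ hh _ U hU _ hgrad w hw => ?_⟩
  · exact (Nat.le_add_right _ _).trans_eq (hwt ν)
  · rw [← hwt ν, IteratedLop.weight, ← Fin.sum_univ_fun_getElem]
    rfl
  · rw [hL ψ h hψ hh U hU hgrad hw]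
    simp only [Finset.sum_apply, Pi.smul_apply, smul_eq_mul]
    refine Finset.sum_congr rfl fun ν _ => ?_
    rw [hg ν, ← Fin.prod_univ_fun_getElem]
    simp only [Pi.mul_apply, Finset.prod_apply, mul_assoc]
    rfl
end
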